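/- Let p > 1, M = ℝⁿ, and let (ρ, φ) be a smooth solution on [0,T] of ∂_t ρ + ∇·(ρ|∇φ|^{p-2}∇φ) = 0 and ∂_t φ + (1/p)|∇φ|^p = 0, with ρ(t) a compactly supported probability density and φ smooth with ∇φ ≠ 0 on the support of ρ. Then the kinetic energy ∫_M |∇φ|^p ρ dv is constant in t. -/

import Mathlib

open Real Set MeasureTheory

/-- Euclidean divergence of a vector field on ℝⁿ. -/
noncomputable def diverg {n : ℕ}
    (v : EuclideanSpace ℝ (Fin n) → EuclideanSpace ℝ (Fin n))
    (x : EuclideanSpace ℝ (Fin n)) : ℝ :=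
  ∑ i, fderiv ℝ (fun y => v y i) x (EuclideanSpace.single i 1)

section aux
open Filter Topology

noncomputable def Ug {n : ℕ} (Φ : ℝ × EuclideanSpace ℝ (Fin n) → ℝ)
    (z : ℝ × EuclideanSpace ℝ (Fin n)) : EuclideanSpace ℝ (Fin n) :=
  (InnerProductSpace.toDual ℝ (EuclideanSpace ℝ (Fin n))).symm
    ((fderiv ℝ Φ z).comp (ContinuousLinearMap.inr ℝ ℝ (EuclideanSpace ℝ (Fin n))))

noncomputable def Vp {n : ℕ} (p : ℝ) (u : EuclideanSpace ℝ (Fin n)) : EuclideanSpace ℝ (Fin n) :=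
  ‖u‖ ^ (p - 2) • u

lemma inner_Ug {n : ℕ} (Φ : ℝ × EuclideanSpace ℝ (Fin n) → ℝ)
    (z : ℝ × EuclideanSpace ℝ (Fin n)) (e : EuclideanSpace ℝ (Fin n)) :
    inner ℝ (Ug Φ z) e = fderiv ℝ Φ z (0, e) := by
  simp [Ug]

lemma contDiff_Ug {n : ℕ} {Φ : ℝ × EuclideanSpace ℝ (Fin n) → ℝ}
    (h : ContDiff ℝ (⊤ : ℕ∞) Φ) : ContDiff ℝ (⊤ : ℕ∞) (Ug Φ) := by
  have h1 : ContDiff ℝ (⊤ : ℕ∞) (fderiv ℝ Φ) := h.fderiv_right (by norm_cast)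
  unfold Ug
  apply (InnerProductSpace.toDual ℝ (EuclideanSpace ℝ (Fin n))).symm.toContinuousLinearEquiv.contDiff.comp
  exact h1.clm_comp contDiff_const

lemma gradient_eq_Ug {n : ℕ} {Φ : ℝ × EuclideanSpace ℝ (Fin n) → ℝ}
    (h : ContDiff ℝ (⊤ : ℕ∞) Φ) (t : ℝ) (x : EuclideanSpace ℝ (Fin n)) :
    gradient (fun y => Φ (t, y)) x = Ug Φ (t, x) := by
  unfold gradient Ug
  congr 1
  have h1 : HasFDerivAt Φ (fderiv ℝ Φ (t, x)) (t, x) :=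
    (h.differentiable (by simp)).differentiableAt.hasFDerivAt
  have := h1.comp x (hasFDerivAt_prodMk_right t x)
  exact this.fderiv

lemma inner_fderiv_Ug {n : ℕ} {Φ : ℝ × EuclideanSpace ℝ (Fin n) → ℝ}
    (h : ContDiff ℝ (⊤ : ℕ∞) Φ) (z a : ℝ × EuclideanSpace ℝ (Fin n))
    (e : EuclideanSpace ℝ (Fin n)) :
    inner ℝ (fderiv ℝ (Ug Φ) z a) e = fderiv ℝ (fderiv ℝ Φ) z a (0, e) := by
  have h1 : ContDiff ℝ (⊤ : ℕ∞) (fderiv ℝ Φ) := h.fderiv_right (by norm_cast)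
  have hd : HasFDerivAt (fderiv ℝ Φ) (fderiv ℝ (fderiv ℝ Φ) z) z :=
    (h1.differentiable (by simp)).differentiableAt.hasFDerivAt
  have hu : HasFDerivAt (Ug Φ) (fderiv ℝ (Ug Φ) z) z :=
    ((contDiff_Ug h).differentiable (by simp)).differentiableAt.hasFDerivAt
  have e1 := hu.inner ℝ (hasFDerivAt_const e z)
  have e2 := hd.clm_apply (hasFDerivAt_const ((0 : ℝ), e) z)
  simp_rw [inner_Ug] at e1
  have := congrArg (fun L => L a) (e1.unique e2)
  simpa using this

lemma key {n : ℕ} {Φ : ℝ × EuclideanSpace ℝ (Fin n) → ℝ} {p : ℝ} (hp : 1 < p)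
    (h : ContDiff ℝ (⊤ : ℕ∞) Φ) (z a : ℝ × EuclideanSpace ℝ (Fin n))
    (hz : ∀ᶠ s : ℝ in 𝓝 0, fderiv ℝ Φ (z + s • a) (1, 0) + (1 / p) * ‖Ug Φ (z + s • a)‖ ^ p = 0) :
    fderiv ℝ (fderiv ℝ Φ) z a (1, Vp p (Ug Φ z)) = 0 := by
  have h1 : ContDiff ℝ (⊤ : ℕ∞) (fderiv ℝ Φ) := h.fderiv_right (by norm_cast)
  have hd : HasFDerivAt (fderiv ℝ Φ) (fderiv ℝ (fderiv ℝ Φ) z) z :=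
    (h1.differentiable (by simp)).differentiableAt.hasFDerivAt
  have hu : HasFDerivAt (Ug Φ) (fderiv ℝ (Ug Φ) z) z :=
    ((contDiff_Ug h).differentiable (by simp)).differentiableAt.hasFDerivAt
  have e2 := hd.clm_apply (hasFDerivAt_const ((1 : ℝ), (0 : EuclideanSpace ℝ (Fin n))) z)
  have e3 := (hasFDerivAt_norm_rpow (Ug Φ z) hp).comp z hu
  have e4 := e2.add (e3.const_mul (1 / p))
  have hl : HasDerivAt (fun s : ℝ => z + s • a) a 0 := by
    simpa using ((hasDerivAt_id (0 : ℝ)).smul_const a).const_add z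
  have e5 := HasFDerivAt.comp_hasDerivAt_of_eq (0 : ℝ) e4 hl (by simp)
  have e6 : HasDerivAt (fun s : ℝ => (0 : ℝ)) _ 0 := e5.congr_of_eventuallyEq (by
    filter_upwards [hz] with s hs
    simpa using hs.symm)
  have e7 := e6.unique (hasDerivAt_const _ _)
  have hp0 : p ≠ 0 := by positivity
  have e8 := inner_fderiv_Ug h z a (Vp p (Ug Φ z))
  have e9 : ((1 : ℝ), Vp p (Ug Φ z)) = ((1 : ℝ), (0 : EuclideanSpace ℝ (Fin n))) + ((0 : ℝ), Vp p (Ug Φ z)) := by simp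
  rw [e9, map_add, ← e8, ← e7]
  simp [Vp, inner_smul_right, real_inner_comm]
  field_simp

lemma norm_Vp_le {n : ℕ} {p : ℝ} (u : EuclideanSpace ℝ (Fin n)) :
    ‖Vp p u‖ ≤ ‖u‖ ^ (p - 1) := by
  unfold Vp
  by_cases hu : u = 0
  · subst hu; simp; try positivity
  · rw [norm_smul, Real.norm_of_nonneg (by positivity)]
    have : 0 < ‖u‖ := norm_pos_iff.2 hu
    rw [← Real.rpow_add_one this.ne']
    apply le_of_eq; congr 1; ring

lemma contDiffAt_Vp {n : ℕ} {p : ℝ} {u : EuclideanSpace ℝ (Fin n)} (hu : u ≠ 0) :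
    ContDiffAt ℝ (⊤ : ℕ∞) (Vp p) u := by
  unfold Vp
  exact ((contDiffAt_norm ℝ hu).rpow_const_of_ne (norm_ne_zero_iff.2 hu)).smul contDiffAt_id

lemma transport {n : ℕ} {Φ : ℝ × EuclideanSpace ℝ (Fin n) → ℝ} {p T : ℝ} (hp : 1 < p)
    (h : ContDiff ℝ (⊤ : ℕ∞) Φ)
    (hHJ : ∀ t ∈ Icc 0 T, ∀ x, fderiv ℝ Φ (t, x) (1, 0) + (1 / p) * ‖Ug Φ (t, x)‖ ^ p = 0)
    {t : ℝ} (ht : t ∈ Icc 0 T) (x : EuclideanSpace ℝ (Fin n)) :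
    fderiv ℝ (Ug Φ) (t, x) (1, Vp p (Ug Φ (t, x))) = 0 := by
  refine ext_inner_right ℝ fun e => ?_
  rw [inner_fderiv_Ug h, inner_zero_left]
  have hs : IsSymmSndFDerivAt ℝ Φ (t, x) :=
    h.contDiffAt.isSymmSndFDerivAt (by simp; try norm_cast)
  rw [hs]
  apply key hp h
  refine Eventually.of_forall fun s => ?_
  have := hHJ t ht (x + s • e)
  simpa using this

/-- pointwise Lipschitz bound along a bounded curve -/
lemma lip_at {n : ℕ} {p : ℝ} (hp : 1 < p) {u : EuclideanSpace ℝ (Fin n)} (hu : u ≠ 0)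
    {w : ℝ → EuclideanSpace ℝ (Fin n)} (hw : Continuous w) (a b : ℝ) :
    ∃ C, 0 ≤ C ∧ ∀ r ∈ Icc a b, ‖Vp p (w r) - Vp p u‖ ≤ C * ‖w r - u‖ := by
  have hd : DifferentiableAt ℝ (Vp p) u := (contDiffAt_Vp hu).differentiableAt (by simp)
  obtain ⟨c, hc⟩ := hd.hasFDerivAt.isBigO_sub.bound
  obtain ⟨δ, hδ, hball⟩ := Metric.eventually_nhds_iff.1 hc
  have hcont : Continuous fun r => ‖w r‖ ^ (p - 1) :=
    hw.norm.rpow_const fun _ => Or.inr (by linarith)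
  obtain ⟨B, hB⟩ := isCompact_Icc.exists_bound_of_continuousOn (s := Icc a b) hcont.continuousOn
  refine ⟨max |c| ((|B| + ‖Vp p u‖) / δ), by positivity, fun r hr => ?_⟩
  by_cases hlt : ‖w r - u‖ < δ
  · refine (hball (by rwa [dist_eq_norm])).trans ?_
    gcongr
    exact (le_abs_self c).trans (le_max_left _ _)
  · push Not at hlt
    have h1 : ‖Vp p (w r) - Vp p u‖ ≤ |B| + ‖Vp p u‖ := by
      refine (norm_sub_le _ _).trans ?_
      gcongr
      exact (norm_Vp_le _).trans ((le_abs_self _).trans ((hB r hr).trans (le_abs_self B)))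
    calc _ ≤ |B| + ‖Vp p u‖ := h1
      _ = ((|B| + ‖Vp p u‖) / δ) * δ := by field_simp
      _ ≤ _ := by gcongr; exact le_max_right _ _

lemma const_line {n : ℕ} {Φ : ℝ × EuclideanSpace ℝ (Fin n) → ℝ} {p T : ℝ} (hp : 1 < p)
    (h : ContDiff ℝ (⊤ : ℕ∞) Φ)
    (hHJ : ∀ t ∈ Icc 0 T, ∀ x, fderiv ℝ Φ (t, x) (1, 0) + (1 / p) * ‖Ug Φ (t, x)‖ ^ p = 0)
    {t : ℝ} (ht : t ∈ Icc 0 T) (x : EuclideanSpace ℝ (Fin n)) (hu : Ug Φ (t, x) ≠ 0) :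
    ∀ s ∈ Icc 0 t, Ug Φ (s, x + (s - t) • Vp p (Ug Φ (t, x))) = Ug Φ (t, x) := by
  set u := Ug Φ (t, x) with hudef
  set v := Vp p u
  let γ : ℝ → ℝ × EuclideanSpace ℝ (Fin n) := fun r => (t - r, x - r • v)
  have hγ : ∀ r, HasDerivAt γ (-1, -v) r := fun r => by
    have h1 : HasDerivAt (fun r : ℝ => t - r) (-1) r := by
      simpa using (hasDerivAt_id r).const_sub t
    have h2 : HasDerivAt (fun r : ℝ => x - r • v) (-v) r := by
      simpa using ((hasDerivAt_id r).smul_const v).const_sub x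
    exact h1.prodMk h2
  have hγc : Continuous γ := by fun_prop
  have hU := contDiff_Ug h
  have hwc : Continuous fun r => Ug Φ (γ r) := hU.continuous.comp hγc
  obtain ⟨C, hC0, hC⟩ := lip_at hp hu hwc 0 t
  have hDc : Continuous fun r => fderiv ℝ (Ug Φ) (γ r) :=
    (hU.continuous_fderiv (by simp)).comp hγc
  obtain ⟨D, hD⟩ := isCompact_Icc.exists_bound_of_continuousOn (s := Icc 0 t) hDc.continuousOn
  have hder : ∀ r, HasDerivAt (fun r => Ug Φ (γ r) - u) (fderiv ℝ (Ug Φ) (γ r) (-1, -v)) r := by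
    intro r
    exact (((hU.differentiable (by simp)).differentiableAt.hasFDerivAt).comp_hasDerivAt r
      (hγ r)).sub_const u
  have hz := eq_zero_of_abs_deriv_le_mul_abs_self_of_eq_zero_right
    (f := fun r => Ug Φ (γ r) - u) (f' := fun r => fderiv ℝ (Ug Φ) (γ r) (-1, -v))
    (K := D * C) (a := 0) (b := t) (hwc.sub continuous_const).continuousOn
    (fun r _ => (hder r).hasDerivWithinAt) (by simp [γ, hudef]) (by
      intro r hr
      have hr' : t - r ∈ Icc 0 T := ⟨by linarith [hr.2], by linarith [hr.1, ht.2]⟩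
      have h0 := transport hp h hHJ hr' (x - r • v)
      have e : ((-1 : ℝ), -v) = (0, Vp p (Ug Φ (γ r)) - v) - (1, Vp p (Ug Φ (γ r))) := by
        simp
      rw [e, map_sub, h0, sub_zero]
      have hrr : r ∈ Icc 0 t := ⟨hr.1, hr.2.le⟩
      calc _ ≤ ‖fderiv ℝ (Ug Φ) (γ r)‖ * ‖((0 : ℝ), Vp p (Ug Φ (γ r)) - v)‖ :=
            ContinuousLinearMap.le_opNorm _ _
        _ ≤ D * (C * ‖Ug Φ (γ r) - u‖) := by
            have h3 := hD r hrr
            have h4 := hC r hrr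
            have : ‖((0 : ℝ), Vp p (Ug Φ (γ r)) - v)‖ = ‖Vp p (Ug Φ (γ r)) - v‖ := by
              simp [Prod.norm_def]
            rw [this]
            gcongr
            exact (norm_nonneg _).trans h3
        _ = _ := by ring)
  intro s hs
  have := hz (t - s) ⟨by linarith [hs.2], by linarith [hs.1]⟩
  have h5 : γ (t - s) = (s, x + (s - t) • v) := by
    simp only [γ, Prod.mk.injEq]
    constructor
    · ring
    · rw [sub_eq_add_neg, ← neg_smul]; congr 2; ring
  rw [← h5]
  exact sub_eq_zero.1 this

lemma diverg_expand {n : ℕ} {Φ P : ℝ × EuclideanSpace ℝ (Fin n) → ℝ} {p : ℝ}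
    (h : ContDiff ℝ (⊤ : ℕ∞) Φ) (hP : ContDiff ℝ (⊤ : ℕ∞) P)
    (t : ℝ) (x : EuclideanSpace ℝ (Fin n)) (hu : Ug Φ (t, x) ≠ 0) :
    diverg (fun y => P (t, y) • Vp p (Ug Φ (t, y))) x =
      fderiv ℝ P (t, x) (0, Vp p (Ug Φ (t, x))) + P (t, x) *
        ∑ i, (fderiv ℝ (Vp p) (Ug Φ (t, x))
          (fderiv ℝ (Ug Φ) (t, x) (0, EuclideanSpace.single i 1))) i := by
  have hPd : HasFDerivAt (fun y => P (t, y)) _ x :=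
    ((hP.differentiable (by simp)).differentiableAt (x := (t, x))).hasFDerivAt.comp x
      (hasFDerivAt_prodMk_right t x)
  have hUd : HasFDerivAt (fun y => Ug Φ (t, y)) _ x :=
    (((contDiff_Ug h).differentiable (by simp)).differentiableAt (x := (t, x))).hasFDerivAt.comp x
      (hasFDerivAt_prodMk_right t x)
  have hVd := HasFDerivAt.comp (g := Vp p) x
    ((contDiffAt_Vp (p := p) hu).differentiableAt (by simp)).hasFDerivAt hUd
  have hv : Vp p (Ug Φ (t, x)) = ∑ i, (Vp p (Ug Φ (t, x))) i • EuclideanSpace.single i (1 : ℝ) := by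
    have := (EuclideanSpace.basisFun (Fin n) ℝ).sum_repr (Vp p (Ug Φ (t, x)))
    simpa using this.symm
  have hv2 : fderiv ℝ P (t, x) (0, Vp p (Ug Φ (t, x))) =
      ∑ i, (Vp p (Ug Φ (t, x))) i * fderiv ℝ P (t, x) (0, EuclideanSpace.single i 1) := by
    have e : ∀ y, fderiv ℝ P (t, x) (0, y) =
        ((fderiv ℝ P (t, x)).comp (ContinuousLinearMap.inr ℝ ℝ _)) y := fun y => by simp
    rw [e]
    conv_lhs => rw [hv]
    rw [map_sum]
    simp
  rw [hv2, Finset.mul_sum, ← Finset.sum_add_distrib]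
  unfold diverg
  refine Finset.sum_congr rfl fun i _ => ?_
  have hVi := (EuclideanSpace.proj (𝕜 := ℝ) i).hasFDerivAt.comp x hVd
  have hm : HasFDerivAt (fun y => (P (t, y) • Vp p (Ug Φ (t, y))) i) _ x := hPd.mul hVi
  rw [hm.fderiv]
  simp
  ring

lemma supp_back {n : ℕ} {Φ P : ℝ × EuclideanSpace ℝ (Fin n) → ℝ} {p T : ℝ} (hp : 1 < p)
    (h : ContDiff ℝ (⊤ : ℕ∞) Φ) (hP : ContDiff ℝ (⊤ : ℕ∞) P)
    (hHJ : ∀ t ∈ Icc 0 T, ∀ x, fderiv ℝ Φ (t, x) (1, 0) + (1 / p) * ‖Ug Φ (t, x)‖ ^ p = 0)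
    (hcont : ∀ t ∈ Icc 0 T, ∀ x, fderiv ℝ P (t, x) (1, 0) +
      diverg (fun y => P (t, y) • Vp p (Ug Φ (t, y))) x = 0)
    {t : ℝ} (ht : t ∈ Icc 0 T) (x : EuclideanSpace ℝ (Fin n)) (hu : Ug Φ (t, x) ≠ 0)
    (hPx : P (t, x) ≠ 0) :
    ∃ y, P (0, y) ≠ 0 ∧ x = y + t • Vp p (Ug Φ (0, y)) := by
  have hline := const_line hp h hHJ ht x hu
  set u := Ug Φ (t, x) with hudef
  set v := Vp p u with hv
  have h0 := hline 0 ⟨le_rfl, ht.1⟩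
  refine ⟨x + (0 - t) • v, ?_, by rw [h0, ← hv]; simp⟩
  intro hzero
  apply hPx
  let γ : ℝ → ℝ × EuclideanSpace ℝ (Fin n) := fun s => (s, x + (s - t) • v)
  have hγ : ∀ r, HasDerivAt γ (1, v) r := fun r => by
    have h2 : HasDerivAt (fun r : ℝ => x + (r - t) • v) v r := by
      simpa using (((hasDerivAt_id r).sub_const t).smul_const v).const_add x
    exact (hasDerivAt_id r).prodMk h2
  have hγc : Continuous γ := by fun_prop
  let c : ℝ → ℝ := fun s => ∑ i, (fderiv ℝ (Vp p) u
          (fderiv ℝ (Ug Φ) (γ s) (0, EuclideanSpace.single i 1))) i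
  have hcc : Continuous c := by
    have hDc : Continuous fun r => fderiv ℝ (Ug Φ) (γ r) :=
      ((contDiff_Ug h).continuous_fderiv (by simp)).comp hγc
    refine continuous_finsetSum _ fun i _ => ?_
    exact (EuclideanSpace.proj (𝕜 := ℝ) i).continuous.comp
      ((fderiv ℝ (Vp p) u).continuous.comp (hDc.clm_apply continuous_const))
  obtain ⟨K, hK⟩ := isCompact_Icc.exists_bound_of_continuousOn (s := Icc 0 t) hcc.continuousOn
  have hz := eq_zero_of_abs_deriv_le_mul_abs_self_of_eq_zero_right
    (f := fun r => P (γ r)) (f' := fun r => fderiv ℝ P (γ r) (1, v))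
    (K := K) (a := 0) (b := t) (hP.continuous.comp hγc).continuousOn
    (fun r _ => (((hP.differentiable (by simp)).differentiableAt.hasFDerivAt).comp_hasDerivAt r
      (hγ r)).hasDerivWithinAt) hzero (by
      intro s hs
      have hs' : s ∈ Icc 0 t := ⟨hs.1, hs.2.le⟩
      have hl := hline s hs'
      have h1 := hcont s ⟨hs.1, hs.2.le.trans ht.2⟩ (x + (s - t) • v)
      rw [diverg_expand h hP s _ (by rw [hl]; exact hu), hl] at h1
      have e : ((1 : ℝ), v) = (1, 0) + (0, v) := by simp
      have h2 : fderiv ℝ P (γ s) (1, v) = - c s * P (γ s) := by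
        rw [e, map_add]
        simp only [γ, c]
        linarith
      rw [h2, norm_mul, norm_neg]
      gcongr
      exact hK s hs')
  simpa [γ] using hz t ⟨ht.1, le_rfl⟩

lemma supp_bound {n : ℕ} {Φ P : ℝ × EuclideanSpace ℝ (Fin n) → ℝ} {p T : ℝ} (hp : 1 < p)
    (hT : 0 < T)
    (h : ContDiff ℝ (⊤ : ℕ∞) Φ) (hP : ContDiff ℝ (⊤ : ℕ∞) P)
    (hHJ : ∀ t ∈ Icc 0 T, ∀ x, fderiv ℝ Φ (t, x) (1, 0) + (1 / p) * ‖Ug Φ (t, x)‖ ^ p = 0)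
    (hcont : ∀ t ∈ Icc 0 T, ∀ x, fderiv ℝ P (t, x) (1, 0) +
      diverg (fun y => P (t, y) • Vp p (Ug Φ (t, y))) x = 0)
    (hgrad : ∀ t ∈ Icc 0 T, ∀ x ∈ tsupport (fun y => P (t, y)), Ug Φ (t, x) ≠ 0)
    (hsupp : HasCompactSupport (fun y => P (0, y))) :
    ∃ R, 0 ≤ R ∧ ∀ t ∈ Icc 0 T, ∀ x, P (t, x) ≠ 0 → ‖x‖ ≤ R := by
  have hc : Continuous fun y => ‖y‖ + T * ‖Ug Φ (0, y)‖ ^ (p - 1) := by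
    have : Continuous fun y => Ug Φ (0, y) := (contDiff_Ug h).continuous.comp (by fun_prop)
    exact continuous_norm.add (continuous_const.mul
      (this.norm.rpow_const fun _ => Or.inr (by linarith)))
  obtain ⟨R, hR⟩ := hsupp.isCompact.exists_bound_of_continuousOn hc.continuousOn
  refine ⟨|R|, abs_nonneg _, fun t ht x hx => ?_⟩
  obtain ⟨y, hy, rfl⟩ := supp_back hp h hP hHJ hcont ht x
    (hgrad t ht x (subset_tsupport _ hx)) hx
  refine le_trans ?_ ((le_abs_self _).trans ((hR y (subset_tsupport _ hy)).trans (le_abs_self R)))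
  refine (norm_add_le _ _).trans ?_
  gcongr
  rw [norm_smul, Real.norm_of_nonneg ht.1]
  have := norm_Vp_le (p := p) (Ug Φ (0, y))
  gcongr
  exact ht.2

lemma param_deriv {n : ℕ} {g : ℝ × EuclideanSpace ℝ (Fin n) → ℝ}
    {χ : EuclideanSpace ℝ (Fin n) → ℝ} (hg : ContDiff ℝ (⊤ : ℕ∞) g)
    (hχ : Continuous χ) (hχs : HasCompactSupport χ) (t : ℝ) :
    HasDerivAt (fun s => ∫ x, χ x * g (s, x)) (∫ x, χ x * fderiv ℝ g (t, x) (1, 0)) t := by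
  have hDc : Continuous fun z => fderiv ℝ g z (1, 0) :=
    (hg.continuous_fderiv (by simp)).clm_apply continuous_const
  obtain ⟨B, hB⟩ := ((isCompact_Icc (a := t - 1) (b := t + 1)).prod
    hχs.isCompact).exists_bound_of_continuousOn hDc.continuousOn
  have hi : ∀ k : EuclideanSpace ℝ (Fin n) → ℝ, Continuous k → Integrable fun x => χ x * k x :=
    fun k hk => (hχ.mul hk).integrable_of_hasCompactSupport hχs.mul_right
  refine (hasDerivAt_integral_of_dominated_loc_of_deriv_le (s := Icc (t - 1) (t + 1))
    (bound := fun x => ‖χ x * B‖)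
    (F' := fun s x => χ x * fderiv ℝ g (s, x) (1, 0)) (Icc_mem_nhds (by linarith) (by linarith))
    (Eventually.of_forall fun s => ?_) ?_ ?_ (ae_of_all _ fun x s hs => ?_) ?_
    (ae_of_all _ fun x s hs => ?_)).2
  · exact (hi _ (hg.continuous.comp (by fun_prop))).aestronglyMeasurable
  · exact hi _ (hg.continuous.comp (by fun_prop))
  · exact (hi _ (hDc.comp (by fun_prop : Continuous fun x => (t, x)))).aestronglyMeasurable
  · by_cases hx : χ x = 0
    · simp [hx]
    · rw [norm_mul, norm_mul]
      gcongr
      exact (hB (s, x) ⟨hs, subset_tsupport _ hx⟩).trans (le_abs_self B)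
  · exact (hi _ continuous_const).norm
  · have h1 : HasDerivAt (fun s : ℝ => (s, x)) (1, 0) s :=
      (hasDerivAt_id s).prodMk (hasDerivAt_const s x)
    exact (((hg.differentiable (by simp)).differentiableAt.hasFDerivAt).comp_hasDerivAt s
      h1).const_mul (χ x)

lemma sum_single_smul {n : ℕ} (v : EuclideanSpace ℝ (Fin n)) :
    ∑ i, v i • EuclideanSpace.single i (1 : ℝ) = v := by
  have := (EuclideanSpace.basisFun (Fin n) ℝ).sum_repr v
  simpa using this

lemma energy_deriv {n : ℕ} {Φ P : ℝ × EuclideanSpace ℝ (Fin n) → ℝ} {p T R : ℝ} (hp : 1 < p)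
    (h : ContDiff ℝ (⊤ : ℕ∞) Φ) (hP : ContDiff ℝ (⊤ : ℕ∞) P)
    (hHJ : ∀ t ∈ Icc 0 T, ∀ x, fderiv ℝ Φ (t, x) (1, 0) + (1 / p) * ‖Ug Φ (t, x)‖ ^ p = 0)
    (hcont : ∀ t ∈ Icc 0 T, ∀ x, fderiv ℝ P (t, x) (1, 0) +
      diverg (fun y => P (t, y) • Vp p (Ug Φ (t, y))) x = 0)
    (hgrad : ∀ t ∈ Icc 0 T, ∀ x ∈ tsupport (fun y => P (t, y)), Ug Φ (t, x) ≠ 0)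
    (hsupp : ∀ t ∈ Icc 0 T, HasCompactSupport (fun y => P (t, y)))
    (hR : ∀ t ∈ Icc 0 T, ∀ x, P (t, x) ≠ 0 → ‖x‖ ≤ R)
    {χ : EuclideanSpace ℝ (Fin n) → ℝ} (hχ : ∀ x, ‖x‖ ≤ R → χ x = 1)
    {t : ℝ} (ht : t ∈ Ioo 0 T) :
    ∫ x, χ x * fderiv ℝ (fun z => fderiv ℝ Φ z (1, 0) * P z) (t, x) (1, 0) = 0 := by
  have htI : t ∈ Icc 0 T := Ioo_subset_Icc_self ht
  have h1 : ContDiff ℝ (⊤ : ℕ∞) (fderiv ℝ Φ) := h.fderiv_right (by norm_cast)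
  have hh : ContDiff ℝ (⊤ : ℕ∞) (fun z => fderiv ℝ Φ z (1, 0)) := h1.clm_apply contDiff_const
  have hhd : ∀ z a, fderiv ℝ (fun z => fderiv ℝ Φ z (1, 0)) z a =
      fderiv ℝ (fderiv ℝ Φ) z a (1, 0) := by
    intro z a
    have hd : HasFDerivAt (fderiv ℝ Φ) (fderiv ℝ (fderiv ℝ Φ) z) z :=
      (h1.differentiable (by simp)).differentiableAt.hasFDerivAt
    have e2 := hd.clm_apply (hasFDerivAt_const ((1 : ℝ), (0 : EuclideanSpace ℝ (Fin n))) z)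
    rw [e2.fderiv]
    simp
  set k : EuclideanSpace ℝ (Fin n) → ℝ := fun y => fderiv ℝ Φ (t, y) (1, 0) with hk
  have hkc : ContDiff ℝ (⊤ : ℕ∞) k := hh.comp (contDiff_prodMk_right t)
  have hkd : ∀ x e, fderiv ℝ k x e = fderiv ℝ (fderiv ℝ Φ) (t, x) (0, e) (1, 0) := by
    intro x e
    rw [← hhd]
    have := ((hh.differentiable (by simp)).differentiableAt (x := (t, x))).hasFDerivAt.comp x
      (hasFDerivAt_prodMk_right t x)
    have h2 : HasFDerivAt k _ x := this
    rw [h2.fderiv]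
    simp
  set W : Fin n → EuclideanSpace ℝ (Fin n) → ℝ :=
    fun i y => (P (t, y) • Vp p (Ug Φ (t, y))) i with hW
  have hWs : ∀ i, HasCompactSupport (W i) := fun i => by
    have : W i = fun y => P (t, y) * Vp p (Ug Φ (t, y)) i := by ext y; simp [hW]
    rw [this]
    exact (hsupp t htI).mul_right
  have hWc : ∀ i, ContDiff ℝ 1 (W i) := fun i => by
    rw [contDiff_iff_contDiffAt]
    intro x
    by_cases hx : x ∈ tsupport (fun y => P (t, y))
    · have hu := hgrad t htI x hx
      have c1 : ContDiffAt ℝ (⊤ : ℕ∞) (fun y => P (t, y)) x :=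
        (hP.comp (contDiff_prodMk_right t)).contDiffAt
      have c2 : ContDiffAt ℝ (⊤ : ℕ∞) (fun y => Ug Φ (t, y)) x :=
        ((contDiff_Ug h).comp (contDiff_prodMk_right t)).contDiffAt
      have c3 := ContDiffAt.comp (g := Vp p) x (contDiffAt_Vp (p := p) hu) c2
      have c4 := (EuclideanSpace.proj (𝕜 := ℝ) i).contDiff.contDiffAt.comp x (c1.smul c3)
      exact c4.of_le (by norm_cast)
    · have : W i =ᶠ[𝓝 x] fun _ => 0 := by
        filter_upwards [notMem_tsupport_iff_eventuallyEq.1 hx] with y hy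
        have hy' : P (t, y) = 0 := hy
        simp [hW, hy']
      exact contDiffAt_const.congr_of_eventuallyEq this
  have hWd : ∀ i, Continuous fun x => fderiv ℝ (W i) x (EuclideanSpace.single i 1) := fun i =>
    ((hWc i).continuous_fderiv (by simp)).clm_apply continuous_const
  have i1 : ∀ i, Integrable fun x => fderiv ℝ k x (EuclideanSpace.single i 1) * W i x := fun i =>
    (((hkc.continuous_fderiv (by simp)).clm_apply continuous_const).mul
      (hWc i).continuous).integrable_of_hasCompactSupport (hWs i).mul_left
  have i2 : ∀ i, Integrable fun x => k x * fderiv ℝ (W i) x (EuclideanSpace.single i 1) := fun i =>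
    (hkc.continuous.mul (hWd i)).integrable_of_hasCompactSupport
      ((hWs i).fderiv_apply ℝ _).mul_left
  have i3 : ∀ i, Integrable fun x => k x * W i x := fun i =>
    (hkc.continuous.mul (hWc i).continuous).integrable_of_hasCompactSupport (hWs i).mul_left
  have ibp : ∀ i, ∫ x, (fderiv ℝ k x (EuclideanSpace.single i 1) * W i x +
      k x * fderiv ℝ (W i) x (EuclideanSpace.single i 1)) = 0 := fun i => by
    rw [integral_add (i1 i) (i2 i), integral_mul_fderiv_eq_neg_fderiv_mul_of_integrable
      (i1 i) (i2 i) (i3 i) (fun x _ => (hkc.differentiable (by simp)).differentiableAt)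
      (fun x _ => ((hWc i).differentiable (by simp)).differentiableAt)]
    ring
  have hpt : ∀ x, χ x * fderiv ℝ (fun z => fderiv ℝ Φ z (1, 0) * P z) (t, x) (1, 0) =
      - ∑ i, (fderiv ℝ k x (EuclideanSpace.single i 1) * W i x +
      k x * fderiv ℝ (W i) x (EuclideanSpace.single i 1)) := by
    intro x
    have hprod : fderiv ℝ (fun z => fderiv ℝ Φ z (1, 0) * P z) (t, x) (1, 0) =
        fderiv ℝ (fderiv ℝ Φ) (t, x) (1, 0) (1, 0) * P (t, x) + k x * fderiv ℝ P (t, x) (1, 0) := by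
      have := ((hh.differentiable (by simp)).differentiableAt (x := (t, x))).hasFDerivAt.mul
        ((hP.differentiable (by simp)).differentiableAt (x := (t, x))).hasFDerivAt
      have h2 : HasFDerivAt (fun z => fderiv ℝ Φ z (1, 0) * P z) _ (t, x) := this
      rw [h2.fderiv, ← hhd]
      simp [hk]
      ring
    have hkey : fderiv ℝ (fderiv ℝ Φ) (t, x) (1, 0) (1, Vp p (Ug Φ (t, x))) = 0 := by
      apply key hp h
      have hev : ∀ᶠ s : ℝ in 𝓝 0, t + s ∈ Ioo 0 T := by
        have : ContinuousAt (fun s : ℝ => t + s) 0 := by fun_prop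
        exact this.eventually_mem (by simpa using Ioo_mem_nhds ht.1 ht.2)
      filter_upwards [hev] with s hs
      simpa using hHJ (t + s) (Ioo_subset_Icc_self hs) x
    have hs : IsSymmSndFDerivAt ℝ Φ (t, x) :=
      h.contDiffAt.isSymmSndFDerivAt (by simp; try norm_cast)
    have hsum : fderiv ℝ (fderiv ℝ Φ) (t, x) (1, 0) (1, 0) =
        - ∑ i, fderiv ℝ k x (EuclideanSpace.single i 1) * Vp p (Ug Φ (t, x)) i := by
      have e : ((1 : ℝ), Vp p (Ug Φ (t, x))) = (1, 0) + (0, Vp p (Ug Φ (t, x))) := by simp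
      rw [e, map_add, hs (1, 0) (0, _), ← hkd] at hkey
      have e2 : fderiv ℝ k x (Vp p (Ug Φ (t, x))) =
          ∑ i, fderiv ℝ k x (EuclideanSpace.single i 1) * Vp p (Ug Φ (t, x)) i := by
        conv_lhs => rw [← sum_single_smul (Vp p (Ug Φ (t, x)))]
        rw [map_sum]
        refine Finset.sum_congr rfl fun i _ => ?_
        simp [mul_comm]
      rw [← e2]
      linarith
    have hd : fderiv ℝ P (t, x) (1, 0) =
        - ∑ i, fderiv ℝ (W i) x (EuclideanSpace.single i 1) := by
      have := hcont t htI x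
      unfold diverg at this
      linarith
    have hmain : fderiv ℝ (fun z => fderiv ℝ Φ z (1, 0) * P z) (t, x) (1, 0) =
      - ∑ i, (fderiv ℝ k x (EuclideanSpace.single i 1) * W i x +
      k x * fderiv ℝ (W i) x (EuclideanSpace.single i 1)) := by
      rw [hprod, hsum, hd, Finset.sum_add_distrib, ← Finset.mul_sum]
      have : ∑ i, fderiv ℝ k x (EuclideanSpace.single i 1) * W i x =
        (∑ i, fderiv ℝ k x (EuclideanSpace.single i 1) * Vp p (Ug Φ (t, x)) i) * P (t, x) := by
        rw [Finset.sum_mul]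
        refine Finset.sum_congr rfl fun i _ => ?_
        simp [hW]
        ring
      rw [this]
      ring
    by_cases hx : ‖x‖ ≤ R
    · rw [hχ x hx, one_mul, hmain]
    · have hz : ∀ i, W i =ᶠ[𝓝 x] fun _ => 0 := fun i => by
        have : ∀ᶠ y in 𝓝 x, R < ‖y‖ :=
          continuous_norm.continuousAt.eventually_const_lt (not_le.1 hx)
        filter_upwards [this] with y hy
        have hy' : P (t, y) = 0 := by
          by_contra hne
          exact absurd (hR t htI y hne) (not_le.2 hy)
        simp [hW, hy']
      have hz0 : ∑ i, (fderiv ℝ k x (EuclideanSpace.single i 1) * W i x +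
        k x * fderiv ℝ (W i) x (EuclideanSpace.single i 1)) = 0 := by
        refine Finset.sum_eq_zero fun i _ => ?_
        rw [(hz i).fderiv_eq, (hz i).eq_of_nhds]
        simp
      rw [hmain, hz0]
      simp
  simp_rw [hpt]
  have hsi : ∀ i ∈ Finset.univ, Integrable fun x =>
      (fderiv ℝ k x (EuclideanSpace.single i 1) * W i x +
      k x * fderiv ℝ (W i) x (EuclideanSpace.single i 1)) := fun i _ => (i1 i).add (i2 i)
  rw [integral_neg, integral_finsetSum _ hsi]
  simp only [ibp]
  simp

lemma energy_const {n : ℕ} {Φ P : ℝ × EuclideanSpace ℝ (Fin n) → ℝ} {p T : ℝ} (hp : 1 < p)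
    (hT : 0 < T)
    (h : ContDiff ℝ (⊤ : ℕ∞) Φ) (hP : ContDiff ℝ (⊤ : ℕ∞) P)
    (hHJ : ∀ t ∈ Icc 0 T, ∀ x, fderiv ℝ Φ (t, x) (1, 0) + (1 / p) * ‖Ug Φ (t, x)‖ ^ p = 0)
    (hcont : ∀ t ∈ Icc 0 T, ∀ x, fderiv ℝ P (t, x) (1, 0) +
      diverg (fun y => P (t, y) • Vp p (Ug Φ (t, y))) x = 0)
    (hgrad : ∀ t ∈ Icc 0 T, ∀ x ∈ tsupport (fun y => P (t, y)), Ug Φ (t, x) ≠ 0)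
    (hsupp : ∀ t ∈ Icc 0 T, HasCompactSupport (fun y => P (t, y))) :
    ∀ t₁ ∈ Icc 0 T, ∀ t₂ ∈ Icc 0 T,
      (∫ x, ‖Ug Φ (t₁, x)‖ ^ p * P (t₁, x)) = ∫ x, ‖Ug Φ (t₂, x)‖ ^ p * P (t₂, x) := by
  obtain ⟨R, hR0, hR⟩ := supp_bound hp hT h hP hHJ hcont hgrad (hsupp 0 ⟨le_rfl, hT.le⟩)
  let χ : ContDiffBump (0 : EuclideanSpace ℝ (Fin n)) :=
    ⟨R + 1, R + 2, by linarith, by linarith⟩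
  have hχ : ∀ x, ‖x‖ ≤ R → χ x = 1 := fun x hx =>
    χ.one_of_mem_closedBall (by simp only [mem_closedBall_zero_iff, χ]; linarith)
  have h1 : ContDiff ℝ (⊤ : ℕ∞) (fderiv ℝ Φ) := h.fderiv_right (by norm_cast)
  have hg : ContDiff ℝ (⊤ : ℕ∞) (fun z => fderiv ℝ Φ z (1, 0) * P z) :=
    (h1.clm_apply contDiff_const).mul hP
  let F : ℝ → ℝ := fun t => ∫ x, χ x * (fderiv ℝ Φ (t, x) (1, 0) * P (t, x))
  have hF : ∀ t, HasDerivAt F _ t := param_deriv hg χ.continuous χ.hasCompactSupport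
  have hE : ∀ t ∈ Icc 0 T, (∫ x, ‖Ug Φ (t, x)‖ ^ p * P (t, x)) = -p * F t := by
    intro t ht
    rw [← integral_const_mul]
    congr 1
    ext x
    by_cases hx : P (t, x) = 0
    · simp [hx]
    · rw [hχ x (hR t ht x hx)]
      have := hHJ t ht x
      have e : ‖Ug Φ (t, x)‖ ^ p = -p * fderiv ℝ Φ (t, x) (1, 0) := by
        have : p ≠ 0 := by positivity
        field_simp at *
        linarith
      rw [e]; ring
  have hlt : ∀ a ∈ Icc 0 T, ∀ b ∈ Icc 0 T, a < b → F a = F b := by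
    intro a ha b hb hab
    obtain ⟨c, hc, hc'⟩ := exists_hasDerivAt_eq_slope F _ hab
      (fun x _ => (hF x).continuousAt.continuousWithinAt) (fun x _ => hF x)
    rw [energy_deriv hp h hP hHJ hcont hgrad hsupp hR hχ
      ⟨ha.1.trans_lt hc.1, hc.2.trans_le hb.2⟩] at hc'
    have : b - a ≠ 0 := by linarith
    field_simp at hc'
    linarith
  intro a ha b hb
  rw [hE a ha, hE b hb]
  rcases lt_trichotomy a b with hab | hab | hab
  · rw [hlt a ha b hb hab]
  · rw [hab]
  · rw [hlt b hb a ha hab]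

lemma deriv_eq_fd {n : ℕ} {Φ : ℝ × EuclideanSpace ℝ (Fin n) → ℝ}
    (h : ContDiff ℝ (⊤ : ℕ∞) Φ) (t : ℝ) (x : EuclideanSpace ℝ (Fin n)) :
    deriv (fun s => Φ (s, x)) t = fderiv ℝ Φ (t, x) (1, 0) := by
  have h1 : HasDerivAt (fun s : ℝ => (s, x)) (1, 0) t :=
    (hasDerivAt_id t).prodMk (hasDerivAt_const t x)
  exact (((h.differentiable (by simp)).differentiableAt.hasFDerivAt).comp_hasDerivAt t h1).deriv

end aux

/-- Along a smooth compactly supported solution of the L^q-geodesic equations on ℝⁿ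
with ∇φ ≠ 0 on the support of ρ, the kinetic energy ∫ |∇φ|^p ρ dv is constant in t. -/
theorem stmt17 (n : ℕ) (p q T : ℝ) (hp : 1 < p) (hq : q = p / (p - 1)) (hT : 0 < T)
    (ρ φ : ℝ → EuclideanSpace ℝ (Fin n) → ℝ)
    (hρsmooth : ContDiff ℝ (⊤ : ℕ∞) (fun z : ℝ × EuclideanSpace ℝ (Fin n) => ρ z.1 z.2))
    (hφsmooth : ContDiff ℝ (⊤ : ℕ∞) (fun z : ℝ × EuclideanSpace ℝ (Fin n) => φ z.1 z.2))
    (hsupp : ∀ t ∈ Icc 0 T, HasCompactSupport (ρ t))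
    (hnonneg : ∀ t ∈ Icc 0 T, ∀ x, 0 ≤ ρ t x)
    (hprob : ∀ t ∈ Icc 0 T, (∫ x, ρ t x) = 1)
    (hgrad : ∀ t ∈ Icc 0 T, ∀ x ∈ tsupport (ρ t), gradient (φ t) x ≠ 0)
    (hcont : ∀ t ∈ Icc 0 T, ∀ x,
      deriv (fun s => ρ s x) t
        + diverg (fun y => ρ t y •
            (‖gradient (φ t) y‖ ^ (p - 2) • gradient (φ t) y)) x = 0)
    (hHJ : ∀ t ∈ Icc 0 T, ∀ x,
      deriv (fun s => φ s x) t + (1 / p) * ‖gradient (φ t) x‖ ^ p = 0) :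
    ∀ t₁ ∈ Icc 0 T, ∀ t₂ ∈ Icc 0 T,
      (∫ x, ‖gradient (φ t₁) x‖ ^ p * ρ t₁ x)
        = ∫ x, ‖gradient (φ t₂) x‖ ^ p * ρ t₂ x := by
  set Φ : ℝ × EuclideanSpace ℝ (Fin n) → ℝ := fun z => φ z.1 z.2 with hΦ
  set P : ℝ × EuclideanSpace ℝ (Fin n) → ℝ := fun z => ρ z.1 z.2 with hPd
  have hgr : ∀ t x, gradient (φ t) x = Ug Φ (t, x) := fun t x => gradient_eq_Ug hφsmooth t x
  simp_rw [hgr]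
  simp_rw [hgr] at hgrad hcont hHJ
  refine energy_const (P := P) hp hT hφsmooth hρsmooth (fun t ht x => ?_) (fun t ht x => ?_)
    hgrad hsupp
  · rw [← deriv_eq_fd hφsmooth]
    exact hHJ t ht x
  · rw [← deriv_eq_fd hρsmooth]
    exact hcont t ht x
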